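/- Let G be a unicyclic graph with cycle C and let S ⊆ V(G) be a branch-resolving set with a_S(C) ≥ 2. Then any two distinct vertices, and also any two distinct edges, lying in the same connected component of G−E(C) are distinguished by some vertex of S. -/

import Mathlib

open SimpleGraph

section Defs

variable {V : Type*}

/-- Distance from a vertex `s` to an edge `e`: the minimum of the distances to its endpoints. -/
noncomputable def edgeDist (G : SimpleGraph V) (s : V) (e : Sym2 V) : ℕ :=
  Sym2.lift ⟨fun u w => min (G.dist s u) (G.dist s w), fun u w => min_comm _ _⟩ e

/-- `S` is a vertex metric generator of `G`. -/
def IsVertexMG (G : SimpleGraph V) (S : Set V) : Prop :=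
  ∀ u v : V, u ≠ v → ∃ s ∈ S, G.dist s u ≠ G.dist s v

/-- `S` is an edge metric generator of `G`. -/
def IsEdgeMG (G : SimpleGraph V) (S : Set V) : Prop :=
  ∀ e ∈ G.edgeSet, ∀ f ∈ G.edgeSet, e ≠ f → ∃ s ∈ S, edgeDist G s e ≠ edgeDist G s f

/-- The vertex metric dimension of `G`. -/
noncomputable def metricDim (G : SimpleGraph V) : ℕ :=
  sInf {n | ∃ S : Finset V, S.card = n ∧ IsVertexMG G ↑S}

/-- The edge metric dimension of `G`. -/
noncomputable def edgeMetricDim (G : SimpleGraph V) : ℕ :=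
  sInf {n | ∃ S : Finset V, S.card = n ∧ IsEdgeMG G ↑S}

/-- `G` is unicyclic: connected, contains a cycle, and any two cycles have the same edges. -/
def IsUnicyclic (G : SimpleGraph V) : Prop :=
  G.Connected ∧ (∃ (u : V) (w : G.Walk u u), w.IsCycle) ∧
    ∀ (u u' : V) (w : G.Walk u u) (w' : G.Walk u' u'), w.IsCycle → w'.IsCycle →
      ∀ e, e ∈ w.edges ↔ e ∈ w'.edges

/-- `vc : ZMod g → V` is a labelling `v_0 v_1 ⋯ v_{g-1}` of a cycle of length `g` in `G`. -/
def IsCycleLabelling (G : SimpleGraph V) (g : ℕ) (vc : ZMod g → V) : Prop :=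
  Function.Injective vc ∧ ∀ i : ZMod g, G.Adj (vc i) (vc (i + 1))

/-- The set of edges of the cycle `C`. -/
def cycleEdges (g : ℕ) (vc : ZMod g → V) : Set (Sym2 V) :=
  {e | ∃ i : ZMod g, e = s(vc i, vc (i + 1))}

/-- The graph `G - E(C)`. -/
def offCycle (G : SimpleGraph V) (g : ℕ) (vc : ZMod g → V) : SimpleGraph V :=
  G.deleteEdges (cycleEdges g vc)

/-- `x` belongs to `T_{v_i}`, the connected component of `G - E(C)` containing `v_i`. -/
def inTree (G : SimpleGraph V) (g : ℕ) (vc : ZMod g → V) (i : ZMod g) (x : V) : Prop :=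
  (offCycle G g vc).Reachable (vc i) x

/-- The vertex `v_i` of the cycle is `S`-active: `T_{v_i}` contains a vertex of `S`. -/
def SActive (G : SimpleGraph V) (g : ℕ) (vc : ZMod g → V) (S : Set V) (i : ZMod g) : Prop :=
  ∃ s ∈ S, inTree G g vc i s

/-- `a_S(C)`: the number of `S`-active vertices on the cycle. -/
noncomputable def aS (G : SimpleGraph V) (g : ℕ) (vc : ZMod g → V) (S : Set V) : ℕ :=
  {i : ZMod g | SActive G g vc S i}.ncard

/-- `S` is biactive: `a_S(C) ≥ 2`. -/
def Biactive (G : SimpleGraph V) (g : ℕ) (vc : ZMod g → V) (S : Set V) : Prop :=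
  2 ≤ aS G g vc S

variable [Fintype V] [DecidableEq V]

/-- `t = u_1 u_2 ⋯ u_k` is a thread hanging at the vertex `v`. -/
def IsThreadAt (G : SimpleGraph V) [DecidableRel G.Adj] (v : V) (t : List V) : Prop :=
  t ≠ [] ∧ t.Nodup ∧ v ∉ t ∧ 3 ≤ G.degree v ∧ List.Chain' G.Adj t ∧
    (∀ u ∈ t.head?, G.Adj v u) ∧ (∀ u ∈ t.getLast?, G.degree u = 1) ∧
    ∀ u ∈ t.dropLast, G.degree u = 2

/-- The thread `t` is `S`-free: it contains no vertex of `S`. -/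
def SFree (S : Set V) (t : List V) : Prop := ∀ u ∈ t, u ∉ S

/-- `S` is branch-resolving: for every vertex, all threads hanging at it except possibly
one contain a vertex of `S` (i.e. at most one thread at each vertex is `S`-free). -/
def BranchResolving (G : SimpleGraph V) [DecidableRel G.Adj] (S : Set V) : Prop :=
  ∀ v : V, ∀ t₁ t₂ : List V, IsThreadAt G v t₁ → IsThreadAt G v t₂ → t₁ ≠ t₂ →
    (∃ s ∈ S, s ∈ t₁) ∨ (∃ s ∈ S, s ∈ t₂)

/-- `ℓ(v)`: the number of threads hanging at `v`. -/
noncomputable def numThreads (G : SimpleGraph V) [DecidableRel G.Adj] (v : V) : ℕ :=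
  {t : List V | IsThreadAt G v t}.ncard

/-- `L(G) = Σ (ℓ(v) - 1)` (truncated subtraction makes the sum run exactly over the
vertices with `ℓ(v) > 1`). -/
noncomputable def LG (G : SimpleGraph V) [DecidableRel G.Adj] : ℕ :=
  ∑ v : V, (numThreads G v - 1)

/-- `x` is a branching vertex of the unicyclic graph with cycle `vc`. -/
def Branching (G : SimpleGraph V) [DecidableRel G.Adj] (g : ℕ) (vc : ZMod g → V) (x : V) :
    Prop :=
  (x ∉ Set.range vc ∧ 3 ≤ G.degree x) ∨ (x ∈ Set.range vc ∧ 4 ≤ G.degree x)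

/-- The cycle vertex `v_i` is branch-active: `T_{v_i}` contains a branching vertex. -/
def BranchActive (G : SimpleGraph V) [DecidableRel G.Adj] (g : ℕ) (vc : ZMod g → V)
    (i : ZMod g) : Prop :=
  ∃ x, inTree G g vc i x ∧ Branching G g vc x

/-- `b(G)`: the number of branch-active vertices on the cycle. -/
noncomputable def bG (G : SimpleGraph V) [DecidableRel G.Adj] (g : ℕ) (vc : ZMod g → V) : ℕ :=
  {i : ZMod g | BranchActive G g vc i}.ncard

/-- `k = max { i : v_i is S-active }` for the labelling `vc` (indices taken in `[0, g-1]`). -/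
noncomputable def kOf (G : SimpleGraph V) (g : ℕ) (vc : ZMod g → V) (S : Set V) : ℕ :=
  sSup {n : ℕ | n < g ∧ SActive G g vc S (n : ZMod g)}

/-- The labelling `vc` of the cycle is canonical with respect to `S`: `v_0` is `S`-active
and `k` is as small as possible among all labellings of the cycle with `v_0` `S`-active. -/
def Canonical (G : SimpleGraph V) (g : ℕ) (vc : ZMod g → V) (S : Set V) : Prop :=
  IsCycleLabelling G g vc ∧ SActive G g vc S 0 ∧
    ∀ vc' : ZMod g → V, IsCycleLabelling G g vc' → Set.range vc' = Set.range vc →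
      SActive G g vc' S 0 → kOf G g vc S ≤ kOf G g vc' S

/-- Configuration 𝒜 : `a_S(C) = 2`, `g` even and `k = g/2`. -/
def ConfigA (G : SimpleGraph V) (g : ℕ) (vc : ZMod g → V) (S : Set V) : Prop :=
  aS G g vc S = 2 ∧ Even g ∧ kOf G g vc S = g / 2

/-- Configuration ℬ : `k ≤ ⌊g/2⌋ - 1` and an `S`-free thread hangs at `v_i` for some
`i ∈ [k, ⌊g/2⌋-1] ∪ [⌈g/2⌉+k+1, g-1] ∪ {0}`. -/
def ConfigB (G : SimpleGraph V) [DecidableRel G.Adj] (g : ℕ) (vc : ZMod g → V) (S : Set V) :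
    Prop :=
  kOf G g vc S ≤ g / 2 - 1 ∧
    ∃ i : ℕ, ((kOf G g vc S ≤ i ∧ i ≤ g / 2 - 1) ∨
        ((g + 1) / 2 + kOf G g vc S + 1 ≤ i ∧ i ≤ g - 1) ∨ i = 0) ∧
      ∃ t : List V, IsThreadAt G (vc (i : ZMod g)) t ∧ SFree S t

/-- Configuration 𝒞 : `a_S(C) = 2`, `g` even, `k ≤ g/2` and an `S`-free thread of length
`≥ g/2 - k` hangs at `v_i` for some `i ∈ [0, k]`. -/
def ConfigC (G : SimpleGraph V) [DecidableRel G.Adj] (g : ℕ) (vc : ZMod g → V) (S : Set V) :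
    Prop :=
  aS G g vc S = 2 ∧ Even g ∧ kOf G g vc S ≤ g / 2 ∧
    ∃ i : ℕ, i ≤ kOf G g vc S ∧
      ∃ t : List V, IsThreadAt G (vc (i : ZMod g)) t ∧ SFree S t ∧
        g / 2 - kOf G g vc S ≤ t.length

/-- Configuration 𝒟 : `k ≤ ⌈g/2⌉ - 1` and an `S`-free thread hangs at `v_i` for some
`i ∈ [k, ⌈g/2⌉-1] ∪ [⌊g/2⌋+k+1, g-1] ∪ {0}`. -/
def ConfigD (G : SimpleGraph V) [DecidableRel G.Adj] (g : ℕ) (vc : ZMod g → V) (S : Set V) :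
    Prop :=
  kOf G g vc S ≤ (g + 1) / 2 - 1 ∧
    ∃ i : ℕ, ((kOf G g vc S ≤ i ∧ i ≤ (g + 1) / 2 - 1) ∨
        (g / 2 + kOf G g vc S + 1 ≤ i ∧ i ≤ g - 1) ∨ i = 0) ∧
      ∃ t : List V, IsThreadAt G (vc (i : ZMod g)) t ∧ SFree S t

/-- Configuration ℰ : `a_S(C) = 2` and an `S`-free thread of length `≥ ⌊g/2⌋ - k + 1`
hangs at `v_i` with `i ∈ [0, k]`; moreover if `g` is even an `S`-free thread hangs at
`v_j` with `j = g/2 + k - i`. -/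
def ConfigE (G : SimpleGraph V) [DecidableRel G.Adj] (g : ℕ) (vc : ZMod g → V) (S : Set V) :
    Prop :=
  aS G g vc S = 2 ∧
    ∃ i : ℕ, i ≤ kOf G g vc S ∧
      (∃ t : List V, IsThreadAt G (vc (i : ZMod g)) t ∧ SFree S t ∧
        g / 2 - kOf G g vc S + 1 ≤ t.length) ∧
      (Even g → ∃ t' : List V,
        IsThreadAt G (vc ((g / 2 + kOf G g vc S - i : ℕ) : ZMod g)) t' ∧ SFree S t')

/-- `G` contains configuration 𝒜 with respect to `S` (evaluated on a canonical labelling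
of the cycle given by `vc`). -/
def ContainsA (G : SimpleGraph V) (g : ℕ) (vc : ZMod g → V) (S : Set V) : Prop :=
  ∃ vc' : ZMod g → V, IsCycleLabelling G g vc' ∧ Set.range vc' = Set.range vc ∧
    Canonical G g vc' S ∧ ConfigA G g vc' S

/-- `G` contains configuration ℬ with respect to `S`. -/
def ContainsB (G : SimpleGraph V) [DecidableRel G.Adj] (g : ℕ) (vc : ZMod g → V)
    (S : Set V) : Prop :=
  ∃ vc' : ZMod g → V, IsCycleLabelling G g vc' ∧ Set.range vc' = Set.range vc ∧
    Canonical G g vc' S ∧ ConfigB G g vc' S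

/-- `G` contains configuration 𝒞 with respect to `S`. -/
def ContainsC (G : SimpleGraph V) [DecidableRel G.Adj] (g : ℕ) (vc : ZMod g → V)
    (S : Set V) : Prop :=
  ∃ vc' : ZMod g → V, IsCycleLabelling G g vc' ∧ Set.range vc' = Set.range vc ∧
    Canonical G g vc' S ∧ ConfigC G g vc' S

/-- `G` contains configuration 𝒟 with respect to `S`. -/
def ContainsD (G : SimpleGraph V) [DecidableRel G.Adj] (g : ℕ) (vc : ZMod g → V)
    (S : Set V) : Prop :=
  ∃ vc' : ZMod g → V, IsCycleLabelling G g vc' ∧ Set.range vc' = Set.range vc ∧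
    Canonical G g vc' S ∧ ConfigD G g vc' S

/-- `G` contains configuration ℰ with respect to `S`. -/
def ContainsE (G : SimpleGraph V) [DecidableRel G.Adj] (g : ℕ) (vc : ZMod g → V)
    (S : Set V) : Prop :=
  ∃ vc' : ZMod g → V, IsCycleLabelling G g vc' ∧ Set.range vc' = Set.range vc ∧
    Canonical G g vc' S ∧ ConfigE G g vc' S

/-- `G` contains one of the configurations 𝒜, ℬ, 𝒞 with respect to `S`. -/
def ContainsABC (G : SimpleGraph V) [DecidableRel G.Adj] (g : ℕ) (vc : ZMod g → V)
    (S : Set V) : Prop :=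
  ContainsA G g vc S ∨ ContainsB G g vc S ∨ ContainsC G g vc S

/-- `G` contains one of the configurations 𝒜, 𝒟, ℰ with respect to `S`. -/
def ContainsADE (G : SimpleGraph V) [DecidableRel G.Adj] (g : ℕ) (vc : ZMod g → V)
    (S : Set V) : Prop :=
  ContainsA G g vc S ∨ ContainsD G g vc S ∨ ContainsE G g vc S

/-- `S` is a smallest branch-resolving set of `G`. -/
def SmallestBR (G : SimpleGraph V) [DecidableRel G.Adj] (S : Finset V) : Prop :=
  BranchResolving G ↑S ∧ ∀ S' : Finset V, BranchResolving G ↑S' → S.card ≤ S'.card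

/-- `S` is a smallest biactive branch-resolving set of `G`. -/
def SmallestBBR (G : SimpleGraph V) [DecidableRel G.Adj] (g : ℕ) (vc : ZMod g → V)
    (S : Finset V) : Prop :=
  BranchResolving G ↑S ∧ Biactive G g vc ↑S ∧
    ∀ S' : Finset V, BranchResolving G ↑S' → Biactive G g vc ↑S' → S.card ≤ S'.card

/-- `G` is 𝒜ℬ𝒞-negative. -/
def ABCneg (G : SimpleGraph V) [DecidableRel G.Adj] (g : ℕ) (vc : ZMod g → V) : Prop :=
  ∃ S : Finset V, SmallestBBR G g vc S ∧ ¬ ContainsABC G g vc ↑S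

/-- `G` is 𝒜𝒟ℰ-negative. -/
def ADEneg (G : SimpleGraph V) [DecidableRel G.Adj] (g : ℕ) (vc : ZMod g → V) : Prop :=
  ∃ S : Finset V, SmallestBBR G g vc S ∧ ¬ ContainsADE G g vc ↑S

end Defs

section Bridges

variable {V : Type*} {G : SimpleGraph V}

/-- `x` lies on the side of `a` when the edge `wa` is deleted from `G`. -/
def OnSide (G : SimpleGraph V) (w a x : V) : Prop :=
  (G.deleteEdges {s(w, a)}).Reachable a x

lemma OnSide.refl (w a : V) : OnSide G w a a := Reachable.refl _

lemma OnSide.step {w a x y : V} (h : OnSide G w a x) (hxy : G.Adj x y)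
    (hne : s(x, y) ≠ s(w, a)) : OnSide G w a y :=
  h.trans (Adj.reachable (by simpa [deleteEdges_adj] using ⟨hxy, by simpa using hne⟩))

lemma SimpleGraph.IsBridge.not_onSide {w a : V} (h : G.IsBridge s(w, a)) : ¬ OnSide G w a w :=
  fun h' => isBridge_iff.1 h h'.symm

lemma SimpleGraph.IsBridge.not_onSide_of_onSide {w a x : V} (h : G.IsBridge s(w, a))
    (hx : OnSide G w a x) : ¬ OnSide G a w x := by
  intro h'
  unfold OnSide at h'
  rw [Sym2.eq_swap] at h'
  exact isBridge_iff.1 h (h'.trans hx.symm)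

lemma OnSide.eq_of_adj_of_not {w a x y : V} (hx : ¬ OnSide G w a x) (hy : OnSide G w a y)
    (hxy : G.Adj x y) : x = w ∧ y = a := by
  by_contra hne
  refine hx (hy.step hxy.symm fun he => ?_)
  rcases Sym2.eq_iff.1 he with ⟨rfl, rfl⟩ | ⟨rfl, rfl⟩
  · exact hx (OnSide.refl _ _)
  · exact hne ⟨rfl, rfl⟩

lemma exists_adj_onSide {K : SimpleGraph V} (hK : K ≤ G) {x y : V} (h : K.Reachable x y)
    (hne : x ≠ y) : ∃ x', K.Adj x x' ∧ OnSide G x x' y := by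
  classical
  obtain ⟨p, hp⟩ := h.exists_isPath
  cases p with
  | nil => exact absurd rfl hne
  | @cons _ x' _ hadj q =>
    refine ⟨x', hadj, ?_⟩
    have hx : x ∉ q.support := ((Walk.cons_isPath_iff _ _).1 hp).2
    exact reachable_deleteEdges_iff_exists_walk.2
      ⟨q.mapLe hK, fun hmem => hx (by
        rw [Walk.edges_mapLe_eq_edges] at hmem
        exact q.fst_mem_support_of_mem_edges hmem)⟩

lemma onSide_or_onSide (hG : G.Connected) (w a x : V) : OnSide G w a x ∨ OnSide G a w x := by
  obtain ⟨p⟩ := hG.preconnected w x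
  by_contra! hcon
  induction p using Walk.concatRec with
  | Hnil => exact hcon.2 (OnSide.refl _ _)
  | @Hconcat u y z p hadj ih =>
    by_cases h1 : OnSide G u a y
    · obtain ⟨rfl, rfl⟩ := OnSide.eq_of_adj_of_not hcon.1 h1 hadj.symm
      exact hcon.2 (OnSide.refl _ _)
    · by_cases h2 : OnSide G a u y
      · obtain ⟨rfl, rfl⟩ := OnSide.eq_of_adj_of_not hcon.2 h2 hadj.symm
        exact hcon.1 (OnSide.refl _ _)
      · exact ih ⟨h1, h2⟩

lemma OnSide.dist_eq (hG : G.Connected) {w a s x : V} (hwa : G.Adj w a)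
    (hs : ¬ OnSide G w a s) (hx : OnSide G w a x) :
    G.dist s x = G.dist s w + 1 + G.dist a x := by
  apply le_antisymm
  · have h1 := hG.dist_triangle (u := s) (v := w) (w := x)
    have h2 := hG.dist_triangle (u := w) (v := a) (w := x)
    rw [dist_eq_one_iff_adj.2 hwa] at h2
    omega
  · obtain ⟨p, hp⟩ := hG.exists_walk_length_eq_dist s x
    rw [← hp]
    clear hp
    induction p with
    | nil => exact absurd hx hs
    | @cons u v x huv q ih =>
      rw [Walk.length_cons]
      by_cases hv : OnSide G w a v
      · obtain ⟨rfl, rfl⟩ := OnSide.eq_of_adj_of_not hs hv huv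
        have := dist_le q
        rw [SimpleGraph.dist_self]
        omega
      · have h1 := ih hv hx
        have h2 := hG.dist_triangle (u := u) (v := v) (w := w)
        rw [dist_eq_one_iff_adj.2 huv] at h2
        omega

lemma OnSide.dist_source_eq (hG : G.Connected) {w a x : V} (hwa : G.Adj w a)
    (hb : G.IsBridge s(w, a)) (hx : OnSide G w a x) : G.dist x w = G.dist x a + 1 := by
  have h := OnSide.dist_eq hG hwa hb.not_onSide hx
  rw [SimpleGraph.dist_self] at h
  rw [SimpleGraph.dist_comm, SimpleGraph.dist_comm (u := x)]
  omega

lemma OnSide.mono {w a a' x : V} (ha : G.Adj a a') (hb : G.IsBridge s(a, a')) (hne : a' ≠ w)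
    (hx : OnSide G a a' x) : OnSide G w a x := by
  obtain ⟨p, hp⟩ := reachable_deleteEdges_iff_exists_walk.1 hx
  have ha' : OnSide G w a a' := (OnSide.refl w a).step ha fun he => by
    rcases Sym2.eq_iff.1 he with ⟨rfl, h⟩ | ⟨-, h⟩
    · exact ha.ne h.symm
    · exact hne h
  refine ha'.trans ?_
  classical
  refine reachable_deleteEdges_iff_exists_walk.2 ⟨p, fun hmem => ?_⟩
  have hsup : a ∈ p.support := p.snd_mem_support_of_mem_edges hmem
  refine hb.not_onSide (reachable_deleteEdges_iff_exists_walk.2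
    ⟨p.takeUntil a hsup, fun h => hp (p.edges_takeUntil_subset_edges hsup h)⟩)

lemma exists_thread_onSide [Fintype V] [DecidableEq V] [DecidableRel G.Adj] {S X : Set V}
    (hbr : BranchResolving G S)
    (hX : ∀ u v, G.Adj u v → u ∉ X → G.IsBridge s(u, v)) (n : ℕ) :
    ∀ w a, {x | OnSide G w a x}.ncard ≤ n → G.Adj w a → G.IsBridge s(w, a) →
      (∀ x, OnSide G w a x → x ∉ X ∧ x ∉ S) →
      ∃ l : List V, (a :: l).Nodup ∧ List.IsChain G.Adj (a :: l) ∧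
        (∀ u ∈ (a :: l).getLast?, G.degree u = 1) ∧
        (∀ u ∈ (a :: l).dropLast, G.degree u = 2) ∧ ∀ u ∈ a :: l, OnSide G w a u := by
  induction n with
  | zero =>
    intro w a hn
    have : a ∈ {x | OnSide G w a x} := OnSide.refl w a
    rw [Nat.le_zero, Set.ncard_eq_zero] at hn
    simp [hn] at this
  | succ n ih =>
    intro w a hn hwa hb hfree
    have key : ∀ a', G.Adj a a' → a' ≠ w → ∃ l : List V, (a' :: l).Nodup ∧
        List.IsChain G.Adj (a' :: l) ∧
        (∀ u ∈ (a' :: l).getLast?, G.degree u = 1) ∧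
        (∀ u ∈ (a' :: l).dropLast, G.degree u = 2) ∧ (∀ u ∈ a' :: l, OnSide G w a u) ∧
        a ∉ a' :: l := by
      intro a' ha' hne
      have hb' : G.IsBridge s(a, a') := hX a a' ha' (hfree a (OnSide.refl _ _)).1
      have hsub : ∀ x, OnSide G a a' x → OnSide G w a x := fun x hx => hx.mono ha' hb' hne
      have hlt : {x | OnSide G a a' x}.ncard < {x | OnSide G w a x}.ncard :=
        Set.ncard_lt_ncard ⟨hsub, fun h => hb'.not_onSide (h (OnSide.refl w a))⟩
      obtain ⟨l, h1, h2, h3, h4, h5⟩ := ih a a' (by omega) ha' hb'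
        fun x hx => hfree x (hsub x hx)
      exact ⟨l, h1, h2, h3, h4, fun u hu => hsub u (h5 u hu),
        fun h => hb'.not_onSide (h5 a h)⟩
    by_cases hex : ∃ a', G.Adj a a' ∧ a' ≠ w
    · obtain ⟨a', ha', hne⟩ := hex
      obtain ⟨l, h1, h2, h3, h4, h5, h6⟩ := key a' ha' hne
      have hdeg : G.degree a = 2 := by
        by_contra hd
        have hsub : ({w, a'} : Finset V) ⊆ G.neighborFinset a := by
          intro z
          simp only [Finset.mem_insert, Finset.mem_singleton, mem_neighborFinset]
          rintro (rfl | rfl)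
          · exact hwa.symm
          · exact ha'
        have hcard := Finset.card_le_card hsub
        rw [Finset.card_pair hne.symm, card_neighborFinset_eq_degree] at hcard
        have hlt : ({w, a'} : Finset V).card < (G.neighborFinset a).card := by
          rw [Finset.card_pair hne.symm, card_neighborFinset_eq_degree]
          omega
        obtain ⟨a'', hmem, hnot⟩ := Finset.exists_mem_notMem_of_card_lt_card hlt
        simp only [Finset.mem_insert, Finset.mem_singleton, not_or, mem_neighborFinset]
          at hmem hnot
        obtain ⟨l', k1, k2, k3, k4, k5, k6⟩ := key a'' hmem hnot.1
        rcases hbr a (a' :: l) (a'' :: l')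
          ⟨by simp, h1, h6, by omega, h2, by simpa using ha', h3, h4⟩
          ⟨by simp, k1, k6, by omega, k2, by simpa using hmem, k3, k4⟩
          (fun h => hnot.2 (List.cons.inj h).1.symm) with ⟨s, hs, hst⟩ | ⟨s, hs, hst⟩
        · exact (hfree s (h5 s hst)).2 hs
        · exact (hfree s (k5 s hst)).2 hs
      refine ⟨a' :: l, List.nodup_cons.2 ⟨h6, h1⟩, List.IsChain.cons_cons ha' h2, ?_, ?_, ?_⟩
      · simpa using h3
      · rw [List.dropLast_cons_of_ne_nil (by simp)]
        intro u hu
        rcases List.mem_cons.1 hu with rfl | hu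
        · exact hdeg
        · exact h4 u hu
      · intro u hu
        rcases List.mem_cons.1 hu with rfl | hu
        · exact OnSide.refl _ _
        · exact h5 u hu
    · push Not at hex
      refine ⟨[], by simp, List.IsChain.singleton a, ?_, by simp, ?_⟩
      · have : G.neighborFinset a = {w} := by
          ext z
          simp only [mem_neighborFinset, Finset.mem_singleton]
          exact ⟨hex z, fun h => h ▸ hwa.symm⟩
        simp [← card_neighborFinset_eq_degree, this]
      · intro u hu
        rw [List.mem_singleton.1 hu]
        exact OnSide.refl _ _

end Bridges

section Unicyclic

variable {V : Type*} {G : SimpleGraph V} {g : ℕ} {vc : ZMod g → V}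

lemma exists_isCycle_of_isCycleLabelling (hg : 3 ≤ g) (hvc : IsCycleLabelling G g vc) :
    ∃ (u : V) (w : G.Walk u u), w.IsCycle ∧ ∀ e ∈ w.edges, e ∈ cycleEdges g vc := by
  have : Fact (1 < g) := ⟨by omega⟩
  set K := fromEdgeSet (cycleEdges g vc) with hK
  have hKadj : ∀ i, K.Adj (vc i) (vc (i + 1)) := fun i =>
    (fromEdgeSet_adj _).2 ⟨⟨i, rfl⟩, (hvc.2 i).ne⟩
  have hKG : K ≤ G := by
    intro x y h
    obtain ⟨⟨i, hi⟩, -⟩ := (fromEdgeSet_adj _).1 h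
    rw [← mem_edgeSet, hi]
    exact hvc.2 i
  have hreach : ∀ n : ℕ, 1 ≤ n → n ≤ g → OnSide K (vc 0) (vc 1) (vc n) := by
    intro n hn
    induction n, hn using Nat.le_induction with
    | base => intro _; simpa using OnSide.refl (G := K) (vc 0) (vc 1)
    | succ n hn ih =>
      intro hng
      have hadj := hKadj (n : ZMod g)
      push_cast
      refine (ih (by omega)).step hadj fun he => ?_
      have hn0 : (n : ZMod g) ≠ 0 := by
        rw [Ne, ZMod.natCast_eq_zero_iff]
        exact fun h => by have := Nat.le_of_dvd (by omega) h; omega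
      rcases Sym2.eq_iff.1 he with ⟨h, -⟩ | ⟨h1, h2⟩
      · exact hn0 (hvc.1 h)
      · have h1 := hvc.1 h1
        have h2 := hvc.1 h2
        rw [h1] at h2
        have h3 : ((2 : ℕ) : ZMod g) = 0 := by push_cast; rw [← h2]; norm_num
        rw [ZMod.natCast_eq_zero_iff] at h3
        have := Nat.le_of_dvd (by omega) h3
        omega
  have hmem : s(vc 0, vc 1) ∈ K.edgeSet := by simpa using hKadj 0
  have hnb : ¬ K.IsBridge s(vc 0, vc 1) := fun h => by
    refine h.not_onSide ?_
    simpa using hreach g (by omega) le_rfl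
  rw [isBridge_iff_forall_cycle_notMem hmem] at hnb
  push Not at hnb
  obtain ⟨u, p, hp, -⟩ := hnb
  refine ⟨u, p.mapLe hKG, hp.mapLe hKG, fun e he => ?_⟩
  rw [Walk.edges_mapLe_eq_edges] at he
  have := p.edges_subset_edgeSet he
  rw [hK, edgeSet_fromEdgeSet] at this
  exact this.1

lemma isBridge_of_offCycle_adj (hG : IsUnicyclic G) (hg : 3 ≤ g)
    (hvc : IsCycleLabelling G g vc) {x y : V} (h : (offCycle G g vc).Adj x y) :
    G.IsBridge s(x, y) := by
  obtain ⟨u, w, hw, hwe⟩ := exists_isCycle_of_isCycleLabelling hg hvc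
  obtain ⟨hadj, hnot⟩ := deleteEdges_adj.1 h
  rw [isBridge_iff_forall_cycle_notMem (by exact hadj)]
  intro v p hp hmem
  exact hnot (hwe _ ((hG.2.2 _ _ _ _ hp hw _).1 hmem))

lemma offCycle_le : offCycle G g vc ≤ G := deleteEdges_le _

lemma offCycle_adj_of_notMem_range {x y : V} (h : G.Adj x y) (hx : x ∉ Set.range vc) :
    (offCycle G g vc).Adj x y := by
  refine deleteEdges_adj.2 ⟨h, ?_⟩
  rintro ⟨i, hi⟩
  rcases Sym2.eq_iff.1 hi with ⟨rfl, -⟩ | ⟨rfl, -⟩ <;> exact hx ⟨_, rfl⟩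

lemma OnSide.cycle_vertex (hg : 3 ≤ g) (hvc : IsCycleLabelling G g vc) {w a : V}
    (hwa : (offCycle G g vc).Adj w a) {i : ZMod g} (hi : OnSide G w a (vc i)) (j : ZMod g) :
    OnSide G w a (vc j) := by
  have : NeZero g := ⟨by omega⟩
  have h : ∀ n : ℕ, OnSide G w a (vc (i + n)) := by
    intro n
    induction n with
    | zero => simpa using hi
    | succ n ih =>
      have := ih.step (hvc.2 _) fun he =>
        (deleteEdges_adj.1 hwa).2 ⟨i + n, he.symm⟩
      push_cast
      rwa [← add_assoc]
  simpa using h (j - i).val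

lemma eq_of_offCycle_reachable (hG : IsUnicyclic G) (hg : 3 ≤ g)
    (hvc : IsCycleLabelling G g vc) {i j : ZMod g}
    (h : (offCycle G g vc).Reachable (vc i) (vc j)) : i = j := by
  by_contra hij
  obtain ⟨x, hx, hside⟩ := exists_adj_onSide offCycle_le h fun h => hij (hvc.1 h)
  exact (isBridge_of_offCycle_adj hG hg hvc hx).not_onSide (hside.cycle_vertex hg hvc hx i)

lemma reachable_of_crossing {K : SimpleGraph V} (hK : K ≤ G) {w a p q : V}
    (h : K.Reachable p q) (hp : OnSide G w a p) (hq : ¬ OnSide G w a q) : K.Reachable p w := by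
  obtain ⟨r⟩ := h
  induction r with
  | nil => exact absurd hp hq
  | @cons u v z huv r ih =>
    by_cases hv : OnSide G w a v
    · exact huv.reachable.trans (ih hv hq)
    · obtain ⟨rfl, -⟩ := OnSide.eq_of_adj_of_not hv hp (hK huv).symm
      exact huv.reachable

lemma exists_active_pair {S : Set V} (hbi : 2 ≤ aS G g vc S) :
    ∃ i j, i ≠ j ∧ ∃ s ∈ S, ∃ t ∈ S, inTree G g vc i s ∧ inTree G g vc j t := by
  obtain ⟨⟨i, hi, j, hj, hij⟩, -⟩ := Set.one_lt_ncard_iff_nontrivial_and_finite.1 hbi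
  obtain ⟨s, hs, hs'⟩ := hi
  obtain ⟨t, ht, ht'⟩ := hj
  exact ⟨i, j, hij, s, hs, t, ht, hs', ht'⟩

lemma cycle_vertex_not_onSide (hG : IsUnicyclic G) (hg : 3 ≤ g)
    (hvc : IsCycleLabelling G g vc) {S : Set V} (hbi : 2 ≤ aS G g vc S) {w a : V}
    (hwa : (offCycle G g vc).Adj w a) (hS : ∀ s ∈ S, ¬ OnSide G w a s) (i : ZMod g) :
    ¬ OnSide G w a (vc i) := by
  intro hi
  obtain ⟨j, k, hjk, s, hs, t, ht, hjs, hkt⟩ := exists_active_pair hbi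
  refine hjk (eq_of_offCycle_reachable hG hg hvc ?_)
  exact (reachable_of_crossing offCycle_le hjs (hi.cycle_vertex hg hvc hwa j) (hS s hs)).trans
    (reachable_of_crossing offCycle_le hkt (hi.cycle_vertex hg hvc hwa k) (hS t ht)).symm

lemma exists_orientation (hG : G.Connected) {e : Sym2 V} {p q : V} (hpq : G.Adj p q)
    (hne : e ≠ s(p, q)) :
    ∃ x x', e = s(x, x') ∧ OnSide G x x' p ∧ OnSide G x x' q := by
  obtain ⟨u, v⟩ := e
  rcases onSide_or_onSide hG u v p with h | h
  · exact ⟨u, v, rfl, h, h.step hpq hne.symm⟩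
  · exact ⟨v, u, Sym2.eq_swap, h, h.step hpq fun h' => hne (Sym2.eq_swap.trans h'.symm)⟩

lemma edgeDist_mk (s x y : V) : edgeDist G s s(x, y) = min (G.dist s x) (G.dist s y) := rfl

variable [Fintype V] [DecidableEq V] [DecidableRel G.Adj]

lemma exists_onSide_of_two_neighbors (hG : IsUnicyclic G) (hg : 3 ≤ g)
    (hvc : IsCycleLabelling G g vc) {S : Set V} (hbr : BranchResolving G S)
    (hbi : 2 ≤ aS G g vc S) {w a b : V} (ha : (offCycle G g vc).Adj w a)
    (hb : (offCycle G g vc).Adj w b) (hab : a ≠ b) :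
    ∃ s ∈ S, OnSide G w a s ∨ OnSide G w b s := by
  by_contra! hcon
  have key : ∀ c, (offCycle G g vc).Adj w c → (∀ s ∈ S, ¬ OnSide G w c s) →
      ∃ l : List V, (3 ≤ G.degree w → IsThreadAt G w (c :: l)) ∧ ∀ s ∈ c :: l, s ∉ S := by
    intro c hc hcS
    have hbridge := isBridge_of_offCycle_adj hG hg hvc hc
    obtain ⟨l, h1, h2, h3, h4, h5⟩ := exists_thread_onSide (X := Set.range vc) hbr
      (fun u v huv hu => isBridge_of_offCycle_adj hG hg hvc (offCycle_adj_of_notMem_range huv hu))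
      _ w c le_rfl (offCycle_le hc) hbridge
      (fun x hx => ⟨by
        rintro ⟨i, rfl⟩
        exact cycle_vertex_not_onSide hG hg hvc hbi hc hcS i hx, fun hs => hcS x hs hx⟩)
    exact ⟨l, fun hd => ⟨by simp, h1, fun h => hbridge.not_onSide (h5 w h), hd, h2,
      by simpa using offCycle_le hc, h3, h4⟩, fun s hs hsS => hcS s hsS (h5 s hs)⟩
  obtain ⟨l₁, h₁, hS₁⟩ := key a ha fun s hs => (hcon s hs).1
  obtain ⟨l₂, h₂, hS₂⟩ := key b hb fun s hs => (hcon s hs).2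
  have hs : ∃ s ∈ S, w ≠ s := by
    obtain ⟨j, k, hjk, s, hs, t, ht, hjs, hkt⟩ := exists_active_pair hbi
    by_contra! hw
    obtain rfl := hw s hs
    obtain rfl := hw t ht
    exact hjk (eq_of_offCycle_reachable hG hg hvc (hjs.trans hkt.symm))
  have hdeg : 3 ≤ G.degree w := by
    obtain ⟨s, hs, hws⟩ := hs
    obtain ⟨c, hc, hcs⟩ := exists_adj_onSide le_rfl (hG.1.preconnected w s) hws
    have hca : a ≠ c := by rintro rfl; exact (hcon s hs).1 hcs
    have hcb : b ≠ c := by rintro rfl; exact (hcon s hs).2 hcs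
    have hsub : ({a, b, c} : Finset V) ⊆ G.neighborFinset w := by
      intro z
      simp only [Finset.mem_insert, Finset.mem_singleton, mem_neighborFinset]
      rintro (rfl | rfl | rfl)
      exacts [offCycle_le ha, offCycle_le hb, hc]
    have := Finset.card_le_card hsub
    rwa [Finset.card_eq_three.2 ⟨a, b, c, hab, hca, hcb, rfl⟩,
      card_neighborFinset_eq_degree] at this
  rcases hbr w _ _ (h₁ hdeg) (h₂ hdeg) (fun h => hab (List.cons.inj h).1) with
    ⟨s, hs, hst⟩ | ⟨s, hs, hst⟩
  · exact hS₁ s hst hs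
  · exact hS₂ s hst hs

/-- Two distinct vertices of the same component of `G - E(C)` are distinguished by `S`. -/
lemma exists_dist_ne_of_offCycle_reachable (hG : IsUnicyclic G) (hg : 3 ≤ g)
    (hvc : IsCycleLabelling G g vc) {S : Set V} (hbr : BranchResolving G S)
    (hbi : 2 ≤ aS G g vc S) {x y : V} (hxy : (offCycle G g vc).Reachable x y) (hne : x ≠ y) :
    ∃ s ∈ S, G.dist s x ≠ G.dist s y := by
  by_contra! hcon
  induction hn : G.dist x y using Nat.strong_induction_on generalizing x y with
  | _ n ih =>
    have hconn := hG.1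
    obtain ⟨x', hx, hxside⟩ := exists_adj_onSide offCycle_le hxy hne
    obtain ⟨y', hy, hyside⟩ := exists_adj_onSide offCycle_le hxy.symm hne.symm
    have hxb := isBridge_of_offCycle_adj hG hg hvc hx
    have hyb := isBridge_of_offCycle_adj hG hg hvc hy
    have hSx : ∀ s ∈ S, OnSide G x x' s := by
      intro s hs
      by_contra h
      have := OnSide.dist_eq hconn (offCycle_le hx) h hxside
      have := hcon s hs
      omega
    have hSy : ∀ s ∈ S, OnSide G y y' s := by
      intro s hs
      by_contra h
      have := OnSide.dist_eq hconn (offCycle_le hy) h hyside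
      have := hcon s hs
      omega
    have hdx : ∀ s ∈ S, G.dist s x = G.dist s x' + 1 := fun s hs =>
      (hSx s hs).dist_source_eq hconn (offCycle_le hx) hxb
    have hdy : ∀ s ∈ S, G.dist s y = G.dist s y' + 1 := fun s hs =>
      (hSy s hs).dist_source_eq hconn (offCycle_le hy) hyb
    by_cases hxy' : x' = y'
    · subst hxy'
      obtain ⟨s, hs, h | h⟩ :=
        exists_onSide_of_two_neighbors hG hg hvc hbr hbi hx.symm hy.symm hne
      · exact hxb.not_onSide_of_onSide (hSx s hs) h
      · exact hyb.not_onSide_of_onSide (hSy s hs) h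
    · obtain ⟨-, -, -, s, hs, -⟩ := exists_active_pair hbi
      have h1 := hxside.dist_source_eq hconn (offCycle_le hx) hxb
      have hx'y : OnSide G y y' x' := by
        refine hyside.step (offCycle_le hx) fun he => ?_
        rcases Sym2.eq_iff.1 he with ⟨h, -⟩ | ⟨-, rfl⟩
        · exact hne h
        · have := hdx s hs
          have := hcon s hs
          omega
      have h2 := hx'y.dist_source_eq hconn (offCycle_le hy) hyb
      rw [SimpleGraph.dist_comm] at h1
      rw [SimpleGraph.dist_comm (u := y)] at h1
      refine ih _ ?_ ((hx.symm.reachable.trans hxy).trans hy.reachable) hxy' ?_ rfl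
      · omega
      · intro s hs
        have := hdx s hs
        have := hdy s hs
        have := hcon s hs
        omega

/-- Two distinct edges of the same component of `G - E(C)` are distinguished by `S`. -/
lemma exists_edgeDist_ne_of_offCycle_reachable (hG : IsUnicyclic G) (hg : 3 ≤ g)
    (hvc : IsCycleLabelling G g vc) {S : Set V} (hbr : BranchResolving G S)
    (hbi : 2 ≤ aS G g vc S) {e f : Sym2 V} (he : e ∈ (offCycle G g vc).edgeSet)
    (hf : f ∈ (offCycle G g vc).edgeSet)
    (hef : ∀ x ∈ e, ∀ y ∈ f, (offCycle G g vc).Reachable x y) (hne : e ≠ f) :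
    ∃ s ∈ S, edgeDist G s e ≠ edgeDist G s f := by
  by_contra! hcon
  have hconn := hG.1
  obtain ⟨x, x', rfl, hx⟩ : ∃ x x', e = s(x, x') ∧ ∀ z ∈ f, OnSide G x x' z := by
    induction f with | _ p q
    rw [mem_edgeSet] at hf
    obtain ⟨x, x', rfl, hp, hq⟩ := exists_orientation hconn (offCycle_le hf) hne
    refine ⟨x, x', rfl, fun z hz => ?_⟩
    rcases Sym2.mem_iff.1 hz with rfl | rfl <;> assumption
  rw [mem_edgeSet] at he
  obtain ⟨y, y', rfl, hy, hy'⟩ := exists_orientation hconn (offCycle_le he) hne.symm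
  rw [mem_edgeSet] at hf
  have hxy := hx y (Sym2.mem_mk_left _ _)
  have hxy' := hx y' (Sym2.mem_mk_right _ _)
  have hxb := isBridge_of_offCycle_adj hG hg hvc he
  have hyb := isBridge_of_offCycle_adj hG hg hvc hf
  simp only [edgeDist_mk] at hcon
  have hSx : ∀ s ∈ S, OnSide G x x' s := by
    intro s hs
    by_contra h
    have := OnSide.dist_eq hconn (offCycle_le he) h hxy
    have := OnSide.dist_eq hconn (offCycle_le he) h hxy'
    have := hcon s hs
    omega
  have hSy : ∀ s ∈ S, OnSide G y y' s := by
    intro s hs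
    by_contra h
    have := OnSide.dist_eq hconn (offCycle_le hf) h hy
    have := OnSide.dist_eq hconn (offCycle_le hf) h hy'
    have := hcon s hs
    omega
  by_cases heq : x' = y'
  · subst heq
    obtain ⟨s, hs, h | h⟩ := exists_onSide_of_two_neighbors hG hg hvc hbr hbi he.symm hf.symm
      (fun h => hne (by rw [h]))
    · exact hxb.not_onSide_of_onSide (hSx s hs) h
    · exact hyb.not_onSide_of_onSide (hSy s hs) h
  · obtain ⟨s, hs, h⟩ := exists_dist_ne_of_offCycle_reachable hG hg hvc hbr hbi
      (hef x' (Sym2.mem_mk_right _ _) y' (Sym2.mem_mk_right _ _)) heq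
    have := (hSx s hs).dist_source_eq hconn (offCycle_le he) hxb
    have := (hSy s hs).dist_source_eq hconn (offCycle_le hf) hyb
    have := hcon s hs
    omega

end Unicyclic

theorem statement_1 {V : Type*} [Fintype V] [DecidableEq V] (G : SimpleGraph V)
    [DecidableRel G.Adj] (hG : IsUnicyclic G) (g : ℕ) (hg : 3 ≤ g)
    (vc : ZMod g → V) (hvc : IsCycleLabelling G g vc)
    (S : Set V) (hbr : BranchResolving G S) (hbi : 2 ≤ aS G g vc S) :
    (∀ x y : V, (offCycle G g vc).Reachable x y → x ≠ y →
        ∃ s ∈ S, G.dist s x ≠ G.dist s y) ∧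
    (∀ e ∈ (offCycle G g vc).edgeSet, ∀ f ∈ (offCycle G g vc).edgeSet,
        (∀ x ∈ e, ∀ y ∈ f, (offCycle G g vc).Reachable x y) → e ≠ f →
        ∃ s ∈ S, edgeDist G s e ≠ edgeDist G s f) :=
  ⟨fun _ _ hxy hne => exists_dist_ne_of_offCycle_reachable hG hg hvc hbr hbi hxy hne,
    fun _ he _ hf hef hne =>
      exists_edgeDist_ne_of_offCycle_reachable hG hg hvc hbr hbi he hf hef hne⟩
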